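/- Let N ≥ 2, let H be a Finsler norm on ℝ^N, let p ≥ 2, and let u be a stable weak solution of the Finsler p-Laplace equation −div(H(∇u)^{p−1}∇H(∇u)) = |u|^{q−1}u in ℝ^N. Assume either p−1 < q < ∞ and N ≤ p(p+3)/(p−1), or p−1 < q < q_c(N,p) and N > p(p+3)/(p−1), where q_c(N,p) := [((p−1)N − p)² + p²(p−2) − p²(p−1)N + 2p²√((p−1)(N−1))] / [(N−p)((p−1)N − p(p+3))]. Then u ≡ 0. -/

import Mathlib

open MeasureTheory Real Set
open scoped RealInnerProductSpace

noncomputable section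

/-- A Finsler norm on `ℝ^N`: a norm of class `C²` away from the origin whose
open unit ball is uniformly convex. -/
def IsFinslerNorm {N : ℕ} (H : EuclideanSpace ℝ (Fin N) → ℝ) : Prop :=
  (∀ x, H x = 0 ↔ x = 0) ∧
  (∀ (c : ℝ) (x : EuclideanSpace ℝ (Fin N)), H (c • x) = |c| * H x) ∧
  (∀ x y, H (x + y) ≤ H x + H y) ∧
  ContDiffOn ℝ 2 H {(0 : EuclideanSpace ℝ (Fin N))}ᶜ ∧
  ∃ Λ : ℝ, 0 < Λ ∧ ∀ ξ : EuclideanSpace ℝ (Fin N), H ξ = 1 →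
    ∀ v : EuclideanSpace ℝ (Fin N), ⟪gradient H ξ, v⟫ = 0 →
      Λ * ‖v‖ ^ 2 ≤ ⟪fderiv ℝ (gradient H) ξ v, v⟫

/-- `u` is a weak solution of the Finsler `p`-Laplace equation
`-div(H(∇u)^{p-1} ∇H(∇u)) = |u|^{q-1} u` in `ℝ^N`. -/
def IsWeakSolutionFinslerP {N : ℕ} (H : EuclideanSpace ℝ (Fin N) → ℝ)
    (u : EuclideanSpace ℝ (Fin N) → ℝ) (p q : ℝ) : Prop :=
  ∀ φ : EuclideanSpace ℝ (Fin N) → ℝ, ContDiff ℝ 1 φ → HasCompactSupport φ →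
    ∫ x, H (gradient u x) ^ (p - 1) * ⟪gradient H (gradient u x), gradient φ x⟫
      = ∫ x, |u x| ^ (q - 1) * u x * φ x

/-- Stability of a weak solution of the Finsler `p`-Laplace equation in `ℝ^N`. -/
def IsStableFinslerP {N : ℕ} (H : EuclideanSpace ℝ (Fin N) → ℝ)
    (u : EuclideanSpace ℝ (Fin N) → ℝ) (p q : ℝ) : Prop :=
  ∀ φ : EuclideanSpace ℝ (Fin N) → ℝ, ContDiff ℝ 1 φ → HasCompactSupport φ →
    0 ≤ (∫ x, (p - 1) * H (gradient u x) ^ (p - 2) *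
            ⟪gradient H (gradient u x), gradient φ x⟫ ^ 2)
        + (∫ x, H (gradient u x) ^ (p - 1) *
            ⟪fderiv ℝ (gradient H) (gradient u x) (gradient φ x), gradient φ x⟫)
        - ∫ x, q * |u x| ^ (q - 1) * φ x ^ 2

theorem quadratic_separation {p d t L S : ℝ} (hp : 2 ≤ p) (ht0 : 0 < t)
    (ht2 : t ^ 2 = d * (d + p - 1)) (hLp : 2 * p < L) (hS0 : 0 ≤ S)
    (hS2 : S ^ 2 = L + 1 + p ^ 2)
    (h3 : (L ^ 2 - 4 * p ^ 2) * d < p ^ 2 * (p - 1) * (L + 2 + 2 * S))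
    (hcon : p ^ 2 * (p - 1) + 2 * p * t ≤ L * d) : False := by
  have hp0 : 0 < p := by linarith
  have hp1 : 0 < p - 1 := by linarith
  have hL0 : 0 < L := by linarith
  have hc0 : 0 < p ^ 2 * (p - 1) := by positivity
  obtain ⟨c, hc⟩ : ∃ c, c = p ^ 2 * (p - 1) := ⟨_, rfl⟩
  rw [← hc] at h3 hcon hc0
  have hK0 : 0 < L ^ 2 - 4 * p ^ 2 := by
    linarith [mul_pos (sub_pos.2 hLp) (show 0 < L + 2 * p by linarith)]
  obtain ⟨K, hK⟩ : ∃ K, K = L ^ 2 - 4 * p ^ 2 := ⟨_, rfl⟩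
  rw [← hK] at h3 hK0
  have h4 : 4 * p ^ 2 * t ^ 2 ≤ (L * d - c) ^ 2 := by
    calc 4 * p ^ 2 * t ^ 2 = (2 * p * t) ^ 2 := by ring
      _ ≤ _ := pow_le_pow_left₀ (by positivity) (by linarith only [hcon]) 2
  have h5 : (2 * c * S) ^ 2 ≤ (c * (L + 2) - K * d) ^ 2 := by
    have h6 : 0 ≤ K * ((L * d - c) ^ 2 - 4 * p ^ 2 * t ^ 2) :=
      mul_nonneg hK0.le (sub_nonneg.2 h4)
    rw [ht2] at h6
    have : (c * (L + 2) - K * d) ^ 2 - (2 * c * S) ^ 2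
      = K * ((L * d - c) ^ 2 - 4 * p ^ 2 * (d * (d + p - 1))) := by
      rw [mul_pow _ S, hS2, hK, hc]; ring
    linarith only [this, h6]
  have h7 : 2 * c * S ≤ c * (L + 2) - K * d := by
    by_contra hh
    have g1 : 0 < 2 * c * S - (c * (L + 2) - K * d) := by linarith only [hh]
    have g2 : 0 < 2 * c * S + (c * (L + 2) - K * d) := by linarith only [h3]
    linarith only [mul_pos g1 g2, h5]
  have h8 : c * K ≤ c * (L * (L + 2 - 2 * S)) := by
    have e1 : K * c ≤ K * (L * d) := mul_le_mul_of_nonneg_left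
        (by linarith only [hcon, mul_pos (mul_pos two_pos hp0) ht0]) hK0.le
    have e2 := mul_le_mul_of_nonneg_left h7 hL0.le
    linarith only [e1, e2]
  have h9 : L * S ≤ L + 2 * p ^ 2 := by
    have := le_of_mul_le_mul_left h8 hc0
    rw [hK] at this
    linarith only [this]
  have h10 : (L * S) ^ 2 ≤ (L + 2 * p ^ 2) ^ 2 := pow_le_pow_left₀ (by positivity) h9 2
  rw [mul_pow, hS2] at h10
  have : 0 < K * (L + p ^ 2) := by positivity
  rw [hK] at this
  linarith only [this, h10]

theorem sqrt_bound_of_lt_critical {n p d : ℝ} (hp : 2 ≤ p) (hd : 0 < d)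
    (h : n > p * (p + 3) / (p - 1))
    (h2 : d + p - 1 < (((p - 1) * n - p) ^ 2 + p ^ 2 * (p - 2) - p ^ 2 * (p - 1) * n +
              2 * p ^ 2 * √((p - 1) * (n - 1))) /
            ((n - p) * ((p - 1) * n - p * (p + 3)))) :
    (p - 1) * n * d < p * ((p + 1) * d + p * (p - 1) + 2 * √(d * (d + p - 1))) := by
  have hp1 : 0 < p - 1 := by linarith
  set t := √(d * (d + p - 1)) with ht
  have htn : 0 ≤ d * (d + p - 1) := mul_nonneg hd.le (by linarith)
  have ht2 : t ^ 2 = d * (d + p - 1) := Real.sq_sqrt htn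
  have htd : d < t := Real.lt_sqrt_of_sq_lt (by nlinarith)
  rw [gt_iff_lt, div_lt_iff₀ hp1] at h
  obtain ⟨L, hL⟩ : ∃ L, L = (p - 1) * n - p * (p + 1) := ⟨_, rfl⟩
  have hLp : 2 * p < L := by rw [hL]; nlinarith
  have hn : 0 < n - p := by
    by_contra hcon
    nlinarith [mul_nonneg hp1.le (not_lt.1 hcon |> sub_nonneg.2)]
  set S := √((p - 1) * (n - 1)) with hS
  have hS0 : 0 ≤ S := Real.sqrt_nonneg _
  have hS2 : S ^ 2 = L + 1 + p ^ 2 := by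
    rw [hS, Real.sq_sqrt (mul_nonneg hp1.le (by linarith)), hL]; ring
  rw [lt_div_iff₀ (mul_pos hn (by linarith))] at h2
  have h3 : (L ^ 2 - 4 * p ^ 2) * d < p ^ 2 * (p - 1) * (L + 2 + 2 * S) := by
    have := mul_lt_mul_of_pos_left h2 hp1
    rw [hL]; linarith
  by_contra hcon
  have hcon' : p ^ 2 * (p - 1) + 2 * p * t ≤ L * d := by rw [hL]; linarith
  exact quadratic_separation hp (hd.trans htd) ht2 hLp hS0 hS2 h3 hcon'

theorem exists_subcritical_exponent {n p q : ℝ} (hp : 2 ≤ p)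
    (hcond : (p - 1 < q ∧ n ≤ p * (p + 3) / (p - 1)) ∨
      (n > p * (p + 3) / (p - 1) ∧ p - 1 < q ∧
        q < (((p - 1) * n - p) ^ 2 + p ^ 2 * (p - 2) - p ^ 2 * (p - 1) * n +
              2 * p ^ 2 * √((p - 1) * (n - 1))) /
            ((n - p) * ((p - 1) * n - p * (p + 3))))) :
    ∃ γ : ℝ, 1 < γ ∧ (p - 1) * (γ + 1) ^ 2 / 4 < q * γ ∧ n * (q - p + 1) < p * (q + γ) := by
  have hq : p - 1 < q := by rcases hcond with h | h <;> [exact h.1; exact h.2.1]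
  obtain ⟨d, hd, rfl⟩ : ∃ d, 0 < d ∧ q = d + p - 1 := ⟨q - p + 1, by linarith, by ring⟩
  have hp1 : 0 < p - 1 := by linarith
  set t := √(d * (d + p - 1)) with ht
  have htn : 0 ≤ d * (d + p - 1) := mul_nonneg hd.le (by linarith)
  have ht2 : t ^ 2 = d * (d + p - 1) := Real.sq_sqrt htn
  have htd : d < t := Real.lt_sqrt_of_sq_lt (by nlinarith)
  have key : (p - 1) * n * d < p * ((p + 1) * d + p * (p - 1) + 2 * t) := by
    rcases hcond with ⟨-, h⟩ | ⟨h, -, h2⟩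
    · rw [le_div_iff₀ hp1] at h
      have := mul_le_mul_of_nonneg_right h hd.le
      nlinarith [mul_pos (show 0 < p by linarith) (sub_pos.2 htd), mul_pos (show 0 < p by linarith) (mul_pos (show 0 < p by linarith) hp1)]
    · exact sqrt_bound_of_lt_critical hp hd h h2
  set γ₀ := (2 * (d + p - 1) - (p - 1) + 2 * t) / (p - 1) with hγ₀
  have hγm : γ₀ * (p - 1) = 2 * (d + p - 1) - (p - 1) + 2 * t := by
    rw [hγ₀]; field_simp
  have hγ1 : 1 < γ₀ := by rw [hγ₀, lt_div_iff₀ hp1]; linarith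
  have hkey2 : n * d < p * (d + p - 1 + γ₀) := by
    have : (p - 1) * (n * d) < (p - 1) * (p * (d + p - 1 + γ₀)) := by
      calc _ = (p - 1) * n * d := by ring
        _ < _ := key
        _ = p * ((p - 1) * (d + p - 1) + γ₀ * (p - 1)) := by rw [hγm]; ring
        _ = _ := by ring
    exact lt_of_mul_lt_mul_left this hp1.le
  have hp0 : 0 < p := by linarith
  -- just below the larger root of the quadratic inequality
  set μ := max 1 (max ((γ₀ * (p - 1) - 4 * t) / (p - 1)) (n * d / p - (d + p - 1))) with hμ
  have hμγ : μ < γ₀ := by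
    refine max_lt hγ1 (max_lt ?_ ?_)
    · rw [div_lt_iff₀ hp1]; linarith
    · rw [sub_lt_iff_lt_add, div_lt_iff₀ hp0]; linarith
  obtain ⟨γ, h1, h2⟩ := exists_between hμγ
  have e1 : 1 < γ := (le_max_left _ _).trans_lt h1
  have e2 : (γ₀ * (p - 1) - 4 * t) / (p - 1) < γ :=
    ((le_max_left _ _).trans (le_max_right _ _)).trans_lt h1
  have e3 : n * d / p - (d + p - 1) < γ :=
    ((le_max_right _ _).trans (le_max_right _ _)).trans_lt h1
  refine ⟨γ, e1, ?_, ?_⟩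
  · rw [div_lt_iff₀ hp1] at e2
    have f1 : 0 < γ₀ * (p - 1) - γ * (p - 1) := by nlinarith
    have f2 : 0 < γ * (p - 1) - (γ₀ * (p - 1) - 4 * t) := by linarith
    have f3 := mul_pos f1 f2
    rw [hγm] at f3
    have f4 : 0 < (p - 1) * ((d + p - 1) * γ * 4 - (p - 1) * (γ + 1) ^ 2) := by
      nlinarith
    have := (mul_pos_iff_of_pos_left hp1).1 f4
    linarith
  · rw [sub_lt_iff_lt_add, div_lt_iff₀ hp0] at e3
    linarith

theorem weighted_young {p q γ j M ε : ℝ} {k : ℕ} (hp : 2 ≤ p) (hq : p - 1 < q) (hγ : 1 < γ)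
    (hj : 0 < j) (hjp : j ≤ p) (hk : p * (q + γ) ≤ 2 * k * (q - p + 1)) (hM : 0 ≤ M)
    (hε : 0 < ε) :
    ∃ K : ℝ, 0 ≤ K ∧ ∀ h a z r : ℝ, 0 ≤ h → 0 ≤ a → 0 ≤ z → z ≤ 1 → 0 < r →
      M * (h ^ (p - j) * a ^ (γ - 1 + j) * z ^ (2 * (k : ℝ) - j) * r ^ (-j)) ≤
        ε * (h ^ p * a ^ (γ - 1) * z ^ (2 * k) + a ^ (q + γ) * z ^ (2 * k)) +
          K * r ^ (-(p * (q + γ) / (q - p + 1))) := by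
  have hp0 : 0 < p := by linarith
  have hqγ : 0 < q + γ := by linarith
  have hd : 0 < q - p + 1 := by linarith
  obtain ⟨α, hα⟩ : ∃ α, α = (p - j) / p := ⟨_, rfl⟩
  obtain ⟨β, hβ⟩ : ∃ β, β = j * (γ + p - 1) / (p * (q + γ)) := ⟨_, rfl⟩
  obtain ⟨δ, hδ⟩ : ∃ δ, δ = j * (q - p + 1) / (p * (q + γ)) := ⟨_, rfl⟩
  have hα0 : 0 ≤ α := by rw [hα]; exact div_nonneg (by linarith) hp0.le
  have hβ0 : 0 ≤ β := by rw [hβ]; exact div_nonneg (mul_nonneg hj.le (by linarith)) (by positivity)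
  have hδ0 : 0 < δ := by rw [hδ]; positivity
  have hsum : α + β + δ = 1 := by rw [hα, hβ, hδ]; field_simp; ring
  have e1 : p * α = p - j := by rw [hα]; field_simp
  have e2 : (γ - 1) * α + (q + γ) * β = γ - 1 + j := by rw [hα, hβ]; field_simp; ring
  have e3 : -(p * (q + γ) / (q - p + 1)) * δ = -j := by rw [hδ]; field_simp
  have e4 : j ≤ 2 * k * δ := by
    rw [hδ, mul_div_assoc', le_div_iff₀ (by positivity)]
    nlinarith
  set K := (M / ε ^ (α + β)) ^ (1 / δ) with hK
  have hMε : 0 ≤ M / ε ^ (α + β) := by positivity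
  refine ⟨K, by positivity, fun h a z r hh ha hz hz1 hr => ?_⟩
  set A := h ^ p * a ^ (γ - 1) * z ^ (2 * k) with hA
  set B := a ^ (q + γ) * z ^ (2 * k) with hB
  set D := r ^ (-(p * (q + γ) / (q - p + 1))) with hD
  have hA0 : 0 ≤ A := by positivity
  have hB0 : 0 ≤ B := by positivity
  have hD0 : 0 ≤ D := by positivity
  have hK0 : 0 ≤ K := by positivity
  have amgm := Real.geom_mean_le_arith_mean3_weighted hα0 hβ0 hδ0.le
    (mul_nonneg hε.le hA0) (mul_nonneg hε.le hB0) (mul_nonneg hK0 hD0) hsum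
  have hKδ : K ^ δ = M / ε ^ (α + β) := by
    rw [hK, ← Real.rpow_mul hMε, one_div_mul_cancel hδ0.ne', Real.rpow_one]
  have hz2 : z ^ (2 * (k : ℝ) - j) ≤ z ^ (2 * (k : ℝ) * α + 2 * k * β) := by
    refine Real.rpow_le_rpow_of_exponent_ge' hz hz1 (by positivity) ?_
    have : 2 * (k : ℝ) * α + 2 * k * β = 2 * k - 2 * k * δ := by
      rw [← mul_add, show α + β = 1 - δ by linarith]; ring
    linarith
  have hzk : z ^ (2 * k) = z ^ (2 * (k : ℝ)) := by
    rw [← Real.rpow_natCast]; push_cast; rfl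
  have prod : (ε * A) ^ α * (ε * B) ^ β * (K * D) ^ δ =
      M * (h ^ (p - j) * a ^ (γ - 1 + j) * z ^ (2 * (k : ℝ) * α + 2 * k * β) * r ^ (-j)) := by
    rw [Real.mul_rpow hε.le hA0, Real.mul_rpow hε.le hB0, Real.mul_rpow hK0 hD0, hKδ, hA, hB, hD,
      hzk, Real.mul_rpow (by positivity) (by positivity), Real.mul_rpow (by positivity) (by positivity),
      Real.mul_rpow (by positivity) (by positivity),
      ← Real.rpow_mul hh, ← Real.rpow_mul ha, ← Real.rpow_mul ha, ← Real.rpow_mul hz,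
      ← Real.rpow_mul hz, ← Real.rpow_mul hr.le, e1, e3, ← e2,
      Real.rpow_add_of_nonneg ha (mul_nonneg (by linarith) hα0) (by positivity),
      Real.rpow_add_of_nonneg hz (by positivity) (by positivity), Real.rpow_add hε]
    field_simp
  calc _ ≤ M * (h ^ (p - j) * a ^ (γ - 1 + j) * z ^ (2 * (k : ℝ) * α + 2 * k * β) * r ^ (-j)) := by
        gcongr
    _ ≤ _ := prod ▸ amgm
    _ ≤ 1 * (ε * A) + 1 * (ε * B) + 1 * (K * D) := by
        gcongr <;> linarith
    _ = _ := by ring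

namespace IsFinslerNorm

variable {N : ℕ} {H : EuclideanSpace ℝ (Fin N) → ℝ}

theorem map_zero (hH : IsFinslerNorm H) : H 0 = 0 := (hH.1 0).2 rfl

theorem smul (hH : IsFinslerNorm H) (c : ℝ) (x : EuclideanSpace ℝ (Fin N)) :
    H (c • x) = |c| * H x := hH.2.1 c x

theorem nonneg (hH : IsFinslerNorm H) (x : EuclideanSpace ℝ (Fin N)) : 0 ≤ H x := by
  have h1 := hH.2.2.1 x ((-1 : ℝ) • x)
  rw [hH.smul, neg_one_smul, add_neg_cancel, hH.map_zero] at h1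
  norm_num at h1
  exact h1

theorem pos (hH : IsFinslerNorm H) {x : EuclideanSpace ℝ (Fin N)} (hx : x ≠ 0) : 0 < H x :=
  (hH.nonneg x).lt_of_ne fun h => hx ((hH.1 x).1 h.symm)

theorem contDiffAt (hH : IsFinslerNorm H) {x : EuclideanSpace ℝ (Fin N)} (hx : x ≠ 0) :
    ContDiffAt ℝ 2 H x :=
  hH.2.2.2.1.contDiffAt (isOpen_compl_singleton.mem_nhds hx)

theorem differentiableAt (hH : IsFinslerNorm H) {x : EuclideanSpace ℝ (Fin N)} (hx : x ≠ 0) :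
    DifferentiableAt ℝ H x :=
  (hH.contDiffAt hx).differentiableAt (by norm_num)

theorem exists_le_norm (hH : IsFinslerNorm H) : ∃ C : ℝ, 0 ≤ C ∧ ∀ x, H x ≤ C * ‖x‖ := by
  have hcont : ContinuousOn H (Metric.sphere (0 : EuclideanSpace ℝ (Fin N)) 1) :=
    hH.2.2.2.1.continuousOn.mono fun x hx => by
      simpa using Metric.ne_of_mem_sphere hx one_ne_zero
  obtain ⟨C, hC⟩ := (isCompact_sphere _ _).exists_bound_of_continuousOn hcont
  refine ⟨max C 0, le_max_right _ _, fun x => ?_⟩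
  rcases eq_or_ne x 0 with rfl | hx
  · simp [hH.map_zero]
  have hx' : 0 < ‖x‖ := norm_pos_iff.2 hx
  have h1 := hC (‖x‖⁻¹ • x) (by simp [norm_smul, hx'.ne'])
  rw [hH.smul, abs_of_pos (inv_pos.2 hx'), Real.norm_eq_abs,
    abs_of_nonneg (mul_nonneg (inv_pos.2 hx').le (hH.nonneg x)), inv_mul_le_iff₀ hx'] at h1
  calc H x ≤ ‖x‖ * C := h1
    _ ≤ ‖x‖ * max C 0 := by gcongr; exact le_max_left _ _
    _ = _ := mul_comm _ _

theorem exists_lipschitz (hH : IsFinslerNorm H) : ∃ C : NNReal, LipschitzWith C H := by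
  obtain ⟨C, hC0, hC⟩ := hH.exists_le_norm
  refine ⟨⟨C, hC0⟩, LipschitzWith.of_le_add_mul _ fun x y => ?_⟩
  have h1 := hH.2.2.1 y (x - y)
  rw [add_sub_cancel] at h1
  rw [dist_eq_norm]
  exact h1.trans (by gcongr; exact hC _)

theorem continuous (hH : IsFinslerNorm H) : Continuous H :=
  hH.exists_lipschitz.choose_spec.continuous

theorem exists_inner_gradient_le (hH : IsFinslerNorm H) :
    ∃ C : ℝ, 0 ≤ C ∧ ∀ ξ v, |⟪gradient H ξ, v⟫| ≤ C * ‖v‖ := by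
  obtain ⟨C, hC⟩ := hH.exists_lipschitz
  refine ⟨C, C.2, fun ξ v => ?_⟩
  rw [inner_gradient_left]
  exact ((fderiv ℝ H ξ).le_opNorm v).trans (by gcongr; exact norm_fderiv_le_of_lipschitz ℝ hC)

theorem inner_gradient_self (hH : IsFinslerNorm H) (ξ : EuclideanSpace ℝ (Fin N)) :
    ⟪gradient H ξ, ξ⟫ = H ξ := by
  rcases eq_or_ne ξ 0 with rfl | hξ
  · simp [hH.map_zero]
  rw [inner_gradient_left]
  have h1 : HasDerivAt (fun t : ℝ => H (t • ξ)) (fderiv ℝ H ξ ξ) 1 := by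
    have h2 : HasDerivAt (fun t : ℝ => t • ξ) ((1 : ℝ) • ξ) 1 := (hasDerivAt_id 1).smul_const ξ
    rw [one_smul] at h2
    have h3 : HasFDerivAt H (fderiv ℝ H ξ) ((fun t : ℝ => t • ξ) 1) := by
      simpa using (hH.differentiableAt hξ).hasFDerivAt
    exact h3.comp_hasDerivAt 1 h2
  have h4 : HasDerivAt (fun t : ℝ => H (t • ξ)) (H ξ) 1 := by
    have h5 : HasDerivAt (fun t : ℝ => t * H ξ) (1 * H ξ) 1 := (hasDerivAt_id 1).mul_const _
    rw [one_mul] at h5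
    refine h5.congr_of_eventuallyEq ?_
    filter_upwards [eventually_gt_nhds one_pos] with t ht
    rw [hH.smul, abs_of_pos ht]
  exact h1.unique h4

theorem gradient_smul (hH : IsFinslerNorm H) {c : ℝ} (hc : 0 < c)
    (ξ : EuclideanSpace ℝ (Fin N)) (hξ : ξ ≠ 0) : gradient H (c • ξ) = gradient H ξ := by
  refine ext_inner_right ℝ fun v => ?_
  rw [inner_gradient_left, inner_gradient_left]
  have h1 : HasFDerivAt (fun x => H (c • x))
      ((fderiv ℝ H (c • ξ)).comp (c • ContinuousLinearMap.id ℝ _)) ξ :=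
    HasFDerivAt.comp ξ (hH.differentiableAt (smul_ne_zero hc.ne' hξ)).hasFDerivAt
      ((hasFDerivAt_id ξ).const_smul c)
  have h2 : HasFDerivAt (fun x => H (c • x)) (c • fderiv ℝ H ξ) ξ := by
    have : (fun x => H (c • x)) = fun x => c • H x := by
      ext x; rw [hH.smul, abs_of_pos hc, smul_eq_mul]
    rw [this]
    exact (hH.differentiableAt hξ).hasFDerivAt.const_smul c
  have h3 := congrArg (fun L => L v) (h1.unique h2)
  simp only [ContinuousLinearMap.comp_apply, smul_apply,
    ContinuousLinearMap.id_apply, _root_.map_smul, smul_eq_mul] at h3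
  exact mul_left_cancel₀ hc.ne' h3

theorem contDiffAt_gradient (hH : IsFinslerNorm H) {ξ : EuclideanSpace ℝ (Fin N)} (hξ : ξ ≠ 0) :
    ContDiffAt ℝ 1 (gradient H) ξ := by
  have h1 : ContDiffAt ℝ 1 (fderiv ℝ H) ξ := (hH.contDiffAt hξ).fderiv_right (by norm_num)
  exact (InnerProductSpace.toDual ℝ (EuclideanSpace ℝ (Fin N))).symm.contDiff.contDiffAt.comp ξ h1

theorem fderiv_gradient_apply_self (hH : IsFinslerNorm H) {ξ : EuclideanSpace ℝ (Fin N)}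
    (hξ : ξ ≠ 0) : fderiv ℝ (gradient H) ξ ξ = 0 := by
  have h2 : HasDerivAt (fun t : ℝ => t • ξ) ((1 : ℝ) • ξ) 1 := (hasDerivAt_id 1).smul_const ξ
  rw [one_smul] at h2
  have h3 : HasFDerivAt (gradient H) (fderiv ℝ (gradient H) ξ) ((fun t : ℝ => t • ξ) 1) := by
    simpa using ((hH.contDiffAt_gradient hξ).differentiableAt (by norm_num)).hasFDerivAt
  have h1 := h3.comp_hasDerivAt 1 h2
  refine h1.unique ((hasDerivAt_const 1 (gradient H ξ)).congr_of_eventuallyEq ?_)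
  filter_upwards [eventually_gt_nhds one_pos] with t ht
  exact hH.gradient_smul ht ξ hξ

theorem inner_fderiv_gradient_self (hH : IsFinslerNorm H) {ξ : EuclideanSpace ℝ (Fin N)}
    (hξ : ξ ≠ 0) (v : EuclideanSpace ℝ (Fin N)) : ⟪fderiv ℝ (gradient H) ξ v, ξ⟫ = 0 := by
  have h1 := ((hH.contDiffAt_gradient hξ).differentiableAt (by norm_num)).hasFDerivAt.inner ℝ
    (hasFDerivAt_id ξ)
  have h2 : (fun x => ⟪gradient H x, id x⟫) = H := funext hH.inner_gradient_self
  rw [h2] at h1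
  have h3 := congrArg (fun L => L v) (h1.unique (hH.differentiableAt hξ).hasFDerivAt)
  simp [fderivInnerCLM_apply, inner_gradient_left] at h3
  exact h3

theorem exists_norm_fderiv_gradient_le (hH : IsFinslerNorm H) :
    ∃ C : ℝ, 0 ≤ C ∧ ∀ ξ, ξ ≠ 0 → H ξ * ‖fderiv ℝ (gradient H) ξ‖ ≤ C := by
  have hcont : ContinuousOn (fderiv ℝ (gradient H))
      (Metric.sphere (0 : EuclideanSpace ℝ (Fin N)) 1) := fun x hx =>
    (((hH.contDiffAt_gradient (Metric.ne_of_mem_sphere hx one_ne_zero)).fderiv_right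
      (m := 0) (by norm_num)).continuousAt).continuousWithinAt
  obtain ⟨C₁, hC₁⟩ := (isCompact_sphere _ _).exists_bound_of_continuousOn hcont
  obtain ⟨C₂, hC₂0, hC₂⟩ := hH.exists_le_norm
  refine ⟨C₂ * max C₁ 0, by positivity, fun ξ hξ => ?_⟩
  have hx' : 0 < ‖ξ‖ := norm_pos_iff.2 hξ
  set c := ‖ξ‖⁻¹ with hc
  have hc0 : 0 < c := inv_pos.2 hx'
  have h1 := hC₁ (c • ξ) (by simp [norm_smul, hc, hx'.ne'])
  have h2 : HasFDerivAt (fun x => gradient H (c • x))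
      ((fderiv ℝ (gradient H) (c • ξ)).comp (c • ContinuousLinearMap.id ℝ _)) ξ :=
    HasFDerivAt.comp ξ ((hH.contDiffAt_gradient (smul_ne_zero hc0.ne' hξ)).differentiableAt
      (by norm_num)).hasFDerivAt ((hasFDerivAt_id ξ).const_smul c)
  have h3 : HasFDerivAt (fun x => gradient H (c • x)) (fderiv ℝ (gradient H) ξ) ξ := by
    refine ((hH.contDiffAt_gradient hξ).differentiableAt
      (by norm_num)).hasFDerivAt.congr_of_eventuallyEq ?_
    filter_upwards [isOpen_compl_singleton.mem_nhds hξ] with x hx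
    exact hH.gradient_smul hc0 x hx
  have h4 : fderiv ℝ (gradient H) ξ = c • fderiv ℝ (gradient H) (c • ξ) := by
    rw [h3.unique h2]; ext v; simp
  rw [h4, norm_smul, Real.norm_eq_abs, abs_of_pos hc0]
  calc H ξ * (c * ‖fderiv ℝ (gradient H) (c • ξ)‖)
      ≤ (C₂ * ‖ξ‖) * (c * max C₁ 0) := by
        gcongr
        · exact hC₂ ξ
        · exact h1.trans (le_max_left _ _)
    _ = C₂ * max C₁ 0 := by rw [hc]; field_simp

theorem exists_hessian_le (hH : IsFinslerNorm H) {p : ℝ} (hp : 2 ≤ p) :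
    ∃ C : ℝ, 0 ≤ C ∧ ∀ (ξ v : EuclideanSpace ℝ (Fin N)) (a b : ℝ),
      H ξ ^ (p - 1) * ⟪fderiv ℝ (gradient H) ξ (a • ξ + b • v), a • ξ + b • v⟫ ≤
        C * (H ξ ^ (p - 2) * (b ^ 2 * ‖v‖ ^ 2)) := by
  obtain ⟨C, hC0, hC⟩ := hH.exists_norm_fderiv_gradient_le
  refine ⟨C, hC0, fun ξ v a b => ?_⟩
  have hH0 := hH.nonneg ξ
  rcases eq_or_ne ξ 0 with rfl | hξ
  · rw [hH.map_zero, Real.zero_rpow (by linarith), zero_mul]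
    have := Real.zero_rpow_nonneg (p - 2)
    positivity
  have e1 : ⟪fderiv ℝ (gradient H) ξ (a • ξ + b • v), a • ξ + b • v⟫ =
      b ^ 2 * ⟪fderiv ℝ (gradient H) ξ v, v⟫ := by
    rw [map_add, _root_.map_smul, _root_.map_smul, hH.fderiv_gradient_apply_self hξ, smul_zero, zero_add,
      inner_add_right, inner_smul_right, real_inner_smul_left, hH.inner_fderiv_gradient_self hξ,
      inner_smul_right, real_inner_smul_left]
    ring
  have e2 : H ξ ^ (p - 1) = H ξ ^ (p - 2) * H ξ := by
    rw [← Real.rpow_add_one' hH0 (by linarith)]; ring_nf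
  have e3 : ⟪fderiv ℝ (gradient H) ξ v, v⟫ ≤ ‖fderiv ℝ (gradient H) ξ‖ * ‖v‖ ^ 2 :=
    calc _ ≤ ‖fderiv ℝ (gradient H) ξ v‖ * ‖v‖ := real_inner_le_norm _ _
      _ ≤ (‖fderiv ℝ (gradient H) ξ‖ * ‖v‖) * ‖v‖ := by
        gcongr; exact ContinuousLinearMap.le_opNorm _ _
      _ = _ := by ring
  rw [e1, e2]
  have hpow : 0 ≤ H ξ ^ (p - 2) := by positivity
  calc H ξ ^ (p - 2) * H ξ * (b ^ 2 * ⟪fderiv ℝ (gradient H) ξ v, v⟫)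
      ≤ H ξ ^ (p - 2) * H ξ * (b ^ 2 * (‖fderiv ℝ (gradient H) ξ‖ * ‖v‖ ^ 2)) := by gcongr
    _ = (H ξ * ‖fderiv ℝ (gradient H) ξ‖) * (H ξ ^ (p - 2) * (b ^ 2 * ‖v‖ ^ 2)) := by ring
    _ ≤ _ := by gcongr; exact hC ξ hξ

theorem measurable_gradient : Measurable (gradient H) :=
  (InnerProductSpace.toDual ℝ (EuclideanSpace ℝ (Fin N))).symm.continuous.measurable.comp
    (measurable_fderiv ℝ H)

end IsFinslerNorm

theorem hasDerivAt_abs_rpow_mul_self {a : ℝ} (ha : 0 < a) (t : ℝ) :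
    HasDerivAt (fun t : ℝ => |t| ^ a * t) ((a + 1) * |t| ^ a) t := by
  rcases eq_or_ne t 0 with rfl | ht
  · rw [abs_zero, Real.zero_rpow ha.ne', mul_zero, hasDerivAt_iff_tendsto_slope]
    have h1 : Filter.Tendsto (fun t : ℝ => |t| ^ a) (nhdsWithin 0 {0}ᶜ) (nhds 0) := by
      have : Continuous fun t : ℝ => |t| ^ a := continuous_abs.rpow_const fun _ => Or.inr ha.le
      have h2 := this.tendsto 0
      simp only [abs_zero, Real.zero_rpow ha.ne'] at h2
      exact h2.mono_left nhdsWithin_le_nhds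
    refine h1.congr' ?_
    filter_upwards [self_mem_nhdsWithin] with s hs
    have hs : s ≠ 0 := hs
    rw [slope_def_field]
    simp [hs]
  · have h1 : HasDerivAt (fun t : ℝ => |t| ^ a) ((SignType.sign t : ℝ) * a * |t| ^ (a - 1)) t :=
      (hasDerivAt_abs ht).rpow_const (Or.inl (abs_ne_zero.2 ht))
    have h2 : HasDerivAt (fun t : ℝ => |t| ^ a * t)
        ((SignType.sign t : ℝ) * a * |t| ^ (a - 1) * t + |t| ^ a * 1) t := h1.mul (hasDerivAt_id t)
    have e : |t| ^ a = |t| ^ (a - 1) * |t| := by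
      rw [← Real.rpow_add_one (abs_ne_zero.2 ht)]; ring_nf
    have e2 : (SignType.sign t : ℝ) * t = |t| := sign_mul_self t
    refine h2.congr_deriv ?_
    linear_combination (a * |t| ^ (a - 1)) * e2 - a * e

theorem contDiff_abs_rpow_mul_self {a : ℝ} (ha : 0 < a) :
    ContDiff ℝ 1 (fun t : ℝ => |t| ^ a * t) := by
  refine contDiff_one_iff_deriv.2
    ⟨fun t => (hasDerivAt_abs_rpow_mul_self ha t).differentiableAt, ?_⟩
  rw [show deriv (fun t : ℝ => |t| ^ a * t) = fun t => (a + 1) * |t| ^ a from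
    funext fun t => (hasDerivAt_abs_rpow_mul_self ha t).deriv]
  exact continuous_const.mul (continuous_abs.rpow_const fun _ => Or.inr ha.le)

theorem gradient_abs_rpow_mul_pow {N : ℕ} {u ζ : EuclideanSpace ℝ (Fin N) → ℝ}
    {a : ℝ} (ha : 0 < a) (m : ℕ) {x : EuclideanSpace ℝ (Fin N)} (hu : DifferentiableAt ℝ u x)
    (hζ : DifferentiableAt ℝ ζ x) :
    gradient (fun x => |u x| ^ a * u x * ζ x ^ m) x =
      ((a + 1) * |u x| ^ a * ζ x ^ m) • gradient u x +
        (|u x| ^ a * u x * (m * ζ x ^ (m - 1))) • gradient ζ x := by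
  have h1 := (hasDerivAt_abs_rpow_mul_self ha (u x)).comp_hasFDerivAt x hu.hasFDerivAt
  have h2 := (hasDerivAt_pow m (ζ x)).comp_hasFDerivAt x hζ.hasFDerivAt
  refine ext_inner_right ℝ fun v => ?_
  rw [inner_gradient_left, inner_add_left, real_inner_smul_left, real_inner_smul_left,
    inner_gradient_left, inner_gradient_left]
  have h3 := (h1.mul h2).fderiv
  change fderiv ℝ (fun x => |u x| ^ a * u x * ζ x ^ m) x = _ at h3
  rw [h3]
  simp
  ring

theorem continuous_gradient {N : ℕ} {u : EuclideanSpace ℝ (Fin N) → ℝ} (hu : ContDiff ℝ 1 u) :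
    Continuous (gradient u) :=
  (InnerProductSpace.toDual ℝ (EuclideanSpace ℝ (Fin N))).symm.continuous.comp
    (hu.continuous_fderiv (by norm_num))

theorem exists_cutoff (N : ℕ) : ∃ C : ℝ, 0 ≤ C ∧ ∀ R : ℝ, 0 < R →
    ∃ ζ : EuclideanSpace ℝ (Fin N) → ℝ, ContDiff ℝ 1 ζ ∧ (∀ x, 0 ≤ ζ x) ∧ (∀ x, ζ x ≤ 1) ∧
      (∀ x ∈ Metric.closedBall 0 R, ζ x = 1) ∧
      (∀ x ∉ Metric.closedBall 0 (2 * R), ζ x = 0) ∧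
      (∀ x ∉ Metric.closedBall 0 (2 * R), gradient ζ x = 0) ∧
      ∀ x, ‖gradient ζ x‖ ≤ C * R⁻¹ := by
  let f : ContDiffBump (0 : EuclideanSpace ℝ (Fin N)) := ⟨1, 2, one_pos, one_lt_two⟩
  have hf : ContDiff ℝ 1 f := f.contDiff
  have hfc : HasCompactSupport (fderiv ℝ f) := f.hasCompactSupport.fderiv ℝ
  obtain ⟨C, hC⟩ := hfc.exists_bound_of_continuous (hf.continuous_fderiv (by norm_num))
  have hC0 : 0 ≤ C := (norm_nonneg _).trans (hC 0)
  refine ⟨C, hC0, fun R hR => ?_⟩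
  have hnorm : ∀ x : EuclideanSpace ℝ (Fin N), ‖R⁻¹ • x‖ = R⁻¹ * ‖x‖ := fun x => by
    rw [norm_smul, Real.norm_eq_abs, abs_of_pos (inv_pos.2 hR)]
  have hzero : ∀ x ∉ Metric.closedBall (0 : EuclideanSpace ℝ (Fin N)) (2 * R),
      f (R⁻¹ • x) = 0 := fun x hx => by
    refine f.zero_of_le_dist ?_
    rw [mem_closedBall_zero_iff, not_le] at hx
    rw [dist_zero_right, hnorm, le_inv_mul_iff₀ hR]
    change R * 2 ≤ _
    linarith
  have hgrad : ∀ x, ‖gradient (fun x => f (R⁻¹ • x)) x‖ ≤ C * R⁻¹ := fun x => by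
    have h1 : HasFDerivAt (fun x => f (R⁻¹ • x))
        ((fderiv ℝ f (R⁻¹ • x)).comp (R⁻¹ • ContinuousLinearMap.id ℝ _)) x :=
      HasFDerivAt.comp (g := f) (f := fun x => R⁻¹ • x) x
        (hf.differentiable (by norm_num) _).hasFDerivAt ((hasFDerivAt_id x).const_smul R⁻¹)
    rw [gradient, LinearIsometryEquiv.norm_map, h1.fderiv]
    have : (fderiv ℝ f (R⁻¹ • x)).comp (R⁻¹ • ContinuousLinearMap.id ℝ _) =
        R⁻¹ • fderiv ℝ f (R⁻¹ • x) := by ext v; simp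
    rw [this, norm_smul, Real.norm_eq_abs, abs_of_pos (inv_pos.2 hR), mul_comm]
    gcongr
    exact hC _
  refine ⟨fun x => f (R⁻¹ • x), hf.comp (contDiff_const_smul R⁻¹), fun x => f.nonneg,
    fun x => f.le_one, fun x hx => f.one_of_mem_closedBall ?_, hzero, fun x hx => ?_, hgrad⟩
  · rw [mem_closedBall_zero_iff] at hx ⊢
    rw [hnorm, inv_mul_le_iff₀ hR]
    change _ ≤ R * 1
    linarith
  · have : (fun x => f (R⁻¹ • x)) =ᶠ[nhds x] fun _ => 0 := by
      filter_upwards [Metric.isClosed_closedBall.isOpen_compl.mem_nhds hx] with y hy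
      exact hzero y hy
    rw [this.gradient_eq, gradient_fun_const]

theorem integral_le_of_le_nonneg {α : Type*} [MeasurableSpace α] {μ : Measure α} {f g : α → ℝ}
    (hg : Integrable g μ) (hg0 : ∀ x, 0 ≤ g x) (hfg : ∀ x, f x ≤ g x) :
    ∫ x, f x ∂μ ≤ ∫ x, g x ∂μ := by
  by_cases hf : Integrable f μ
  · exact integral_mono hf hg hfg
  · rw [integral_undef hf]
    exact integral_nonneg hg0

theorem cross_term_le {p γ C h z r m t : ℝ} {k : ℕ} (hγ : 1 < γ) (hk : 1 ≤ k)
    (hh : 0 ≤ h) (hz : 0 ≤ z) (hm : |m| ≤ C * r⁻¹) :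
    |h ^ (p - 1) * (|t| ^ (γ - 1) * t * z ^ (2 * k - 1) * m)| ≤
      C * (h ^ (p - 1) * |t| ^ (γ - 1 + 1) * z ^ (2 * (k : ℝ) - 1) * r ^ (-1 : ℝ)) := by
  have e1 : |t| ^ (γ - 1 + 1) = |t| ^ (γ - 1) * |t| :=
    Real.rpow_add_one' (abs_nonneg t) (by linarith)
  have e2 : z ^ (2 * (k : ℝ) - 1) = z ^ (2 * k - 1) := by
    rw [← Real.rpow_natCast, Nat.cast_sub (by omega)]
    push_cast; rfl
  rw [e1, e2, Real.rpow_neg_one, abs_mul, abs_mul, abs_mul, abs_mul,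
    abs_of_nonneg (Real.rpow_nonneg hh _), abs_of_nonneg (Real.rpow_nonneg (abs_nonneg t) _),
    abs_of_nonneg (pow_nonneg hz _)]
  calc h ^ (p - 1) * (|t| ^ (γ - 1) * |t| * z ^ (2 * k - 1) * |m|)
      ≤ h ^ (p - 1) * (|t| ^ (γ - 1) * |t| * z ^ (2 * k - 1) * (C * r⁻¹)) := by gcongr
    _ = _ := by ring

theorem square_term_le {p γ C h z r m t : ℝ} {k : ℕ} (hγ : 1 < γ) (hk : 1 ≤ k)
    (hh : 0 ≤ h) (hr : 0 < r) (hm : |m| ≤ C * r⁻¹) :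
    h ^ (p - 2) * ((|t| ^ ((γ - 1) / 2) * t * (k * z ^ (k - 1))) ^ 2 * m ^ 2) ≤
      k ^ 2 * C ^ 2 *
        (h ^ (p - 2) * |t| ^ (γ - 1 + 2) * z ^ (2 * (k : ℝ) - 2) * r ^ (-2 : ℝ)) := by
  have e1 : |t| ^ (γ - 1 + 2) = (|t| ^ ((γ - 1) / 2) * t) ^ 2 := by
    rw [mul_pow, ← sq_abs t, Real.rpow_add_of_nonneg (abs_nonneg t) (by linarith) (by norm_num),
      ← Real.rpow_mul_natCast (abs_nonneg t), ← Real.rpow_natCast |t| 2]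
    norm_num
  have e2 : z ^ (2 * (k : ℝ) - 2) = (z ^ (k - 1)) ^ 2 := by
    rw [← pow_mul, ← Real.rpow_natCast, Nat.cast_mul, Nat.cast_sub hk]
    push_cast; ring_nf
  have e3 : r ^ (-2 : ℝ) = (r⁻¹) ^ 2 := by
    rw [Real.rpow_neg hr.le, inv_pow]; norm_num
  have e4 : m ^ 2 ≤ (C * r⁻¹) ^ 2 := by
    rw [← sq_abs m]; exact pow_le_pow_left₀ (abs_nonneg m) hm 2
  rw [e1, e2, e3]
  have hp' := Real.rpow_nonneg hh (p - 2)
  calc h ^ (p - 2) * ((|t| ^ ((γ - 1) / 2) * t * (k * z ^ (k - 1))) ^ 2 * m ^ 2)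
      ≤ h ^ (p - 2) * ((|t| ^ ((γ - 1) / 2) * t * (k * z ^ (k - 1))) ^ 2 * (C * r⁻¹) ^ 2) := by
        gcongr
    _ = _ := by ring

theorem weak_integrand_lower_bound {p q γ C ε : ℝ} {k : ℕ} (hp : 2 ≤ p) (hq : p - 1 < q)
    (hγ : 1 < γ) (hk1 : 1 ≤ k) (hk : p * (q + γ) ≤ 2 * k * (q - p + 1)) (hC : 0 ≤ C)
    (hε : 0 < ε) :
    ∃ K : ℝ, 0 ≤ K ∧ ∀ h z r m t : ℝ, 0 ≤ h → 0 ≤ z → z ≤ 1 → 0 < r → |m| ≤ C * r⁻¹ →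
      γ * (h ^ p * |t| ^ (γ - 1) * z ^ (2 * k)) -
          ε * (h ^ p * |t| ^ (γ - 1) * z ^ (2 * k) + |t| ^ (q + γ) * z ^ (2 * k)) -
          K * r ^ (-(p * (q + γ) / (q - p + 1))) ≤
        h ^ (p - 1) * ((γ - 1 + 1) * |t| ^ (γ - 1) * z ^ (2 * k) * h +
          |t| ^ (γ - 1) * t * ((2 * k : ℕ) * z ^ (2 * k - 1)) * m) := by
  obtain ⟨K, hK0, hK⟩ := weighted_young (j := 1) (M := 2 * k * C) hp hq hγ one_pos (by linarith) hk
    (by positivity) hε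
  refine ⟨K, hK0, fun h z r m t hh hz hz1 hr hm => ?_⟩
  have h1 := hK h |t| z r hh (abs_nonneg t) hz hz1 hr
  have h2 := neg_le_of_abs_le (cross_term_le (p := p) (t := t) hγ hk1 hh hz hm)
  have h3 := mul_le_mul_of_nonneg_left h2 (show 0 ≤ 2 * (k : ℝ) by positivity)
  have e1 : h ^ p = h ^ (p - 1) * h := by
    rw [← Real.rpow_add_one' hh (by linarith)]; ring_nf
  push_cast
  calc _ ≤ γ * (h ^ p * |t| ^ (γ - 1) * z ^ (2 * k)) + 2 * k *
        (h ^ (p - 1) * (|t| ^ (γ - 1) * t * z ^ (2 * k - 1) * m)) := by linarith only [h1, h3]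
    _ = _ := by rw [e1]; ring

theorem stability_integrand_upper_bound {p q γ C ε : ℝ} {k : ℕ} (hp : 2 ≤ p) (hq : p - 1 < q)
    (hγ : 1 < γ) (hk1 : 1 ≤ k) (hk : p * (q + γ) ≤ 2 * k * (q - p + 1)) (hC : 0 ≤ C)
    (hε : 0 < ε) :
    ∃ K : ℝ, 0 ≤ K ∧ ∀ h z r m t : ℝ, 0 ≤ h → 0 ≤ z → z ≤ 1 → 0 < r → |m| ≤ C * r⁻¹ →
      (p - 1) * h ^ (p - 2) * (((γ - 1) / 2 + 1) * |t| ^ ((γ - 1) / 2) * z ^ k * h +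
          |t| ^ ((γ - 1) / 2) * t * (k * z ^ (k - 1)) * m) ^ 2 ≤
        (p - 1) * (γ + 1) ^ 2 / 4 * (h ^ p * |t| ^ (γ - 1) * z ^ (2 * k)) +
          ε * (h ^ p * |t| ^ (γ - 1) * z ^ (2 * k) + |t| ^ (q + γ) * z ^ (2 * k)) +
          K * r ^ (-(p * (q + γ) / (q - p + 1))) := by
  have hp1 : 0 ≤ p - 1 := by linarith
  obtain ⟨K₁, hK₁0, hK₁⟩ := weighted_young (j := 1) (M := (p - 1) * (γ + 1) * k * C) hp hq hγ
    one_pos (by linarith) hk (by positivity) (half_pos hε)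
  obtain ⟨K₂, hK₂0, hK₂⟩ := weighted_young (j := 2) (M := (p - 1) * (k ^ 2 * C ^ 2)) hp hq hγ
    two_pos hp hk (by positivity) (half_pos hε)
  refine ⟨K₁ + K₂, by positivity, fun h z r m t hh hz hz1 hr hm => ?_⟩
  have h1 := hK₁ h |t| z r hh (abs_nonneg t) hz hz1 hr
  have h2 := hK₂ h |t| z r hh (abs_nonneg t) hz hz1 hr
  have h3 := mul_le_mul_of_nonneg_left
    (le_of_abs_le (cross_term_le (p := p) (t := t) hγ hk1 hh hz hm))
    (show 0 ≤ (p - 1) * (γ + 1) * (k : ℝ) by positivity)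
  have h4 := mul_le_mul_of_nonneg_left
    (square_term_le (p := p) (z := z) (t := t) hγ hk1 hh hr hm) hp1
  have e0 : h ^ (p - 1) = h ^ (p - 2) * h := by
    rw [← Real.rpow_add_one' hh (by linarith)]; ring_nf
  have e1 : h ^ p = h ^ (p - 2) * h * h := by
    rw [← e0, ← Real.rpow_add_one' hh (by linarith)]; ring_nf
  have e2 : |t| ^ (γ - 1) = (|t| ^ ((γ - 1) / 2)) ^ 2 := by
    rw [← Real.rpow_mul_natCast (abs_nonneg t)]; norm_num
  have e3 : z ^ (2 * k - 1) = z ^ k * z ^ (k - 1) := by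
    rw [← pow_add]; congr 1; omega
  calc _ = (p - 1) * (γ + 1) ^ 2 / 4 * (h ^ p * |t| ^ (γ - 1) * z ^ (2 * k)) +
        (p - 1) * (γ + 1) * k * (h ^ (p - 1) * (|t| ^ (γ - 1) * t * z ^ (2 * k - 1) * m)) +
        (p - 1) * (h ^ (p - 2) *
          ((|t| ^ ((γ - 1) / 2) * t * (k * z ^ (k - 1))) ^ 2 * m ^ 2)) := by
        rw [e0, e1, e2, e3]; ring
    _ ≤ _ := by linarith only [h1, h2, h3, h4]

theorem hessian_integrand_upper_bound {p q γ C C' ε : ℝ} {k : ℕ} (hp : 2 ≤ p) (hq : p - 1 < q)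
    (hγ : 1 < γ) (hk1 : 1 ≤ k) (hk : p * (q + γ) ≤ 2 * k * (q - p + 1)) (hC' : 0 ≤ C')
    (hε : 0 < ε) :
    ∃ K : ℝ, 0 ≤ K ∧ ∀ h z r m t : ℝ, 0 ≤ h → 0 ≤ z → z ≤ 1 → 0 < r → |m| ≤ C * r⁻¹ →
      C' * (h ^ (p - 2) * ((|t| ^ ((γ - 1) / 2) * t * (k * z ^ (k - 1))) ^ 2 * m ^ 2)) ≤
          ε * (h ^ p * |t| ^ (γ - 1) * z ^ (2 * k) + |t| ^ (q + γ) * z ^ (2 * k)) +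
          K * r ^ (-(p * (q + γ) / (q - p + 1))) := by
  obtain ⟨K, hK0, hK⟩ := weighted_young (j := 2) (M := C' * (k ^ 2 * C ^ 2)) hp hq hγ
    two_pos hp hk (by positivity) hε
  refine ⟨K, hK0, fun h z r m t hh hz hz1 hr hm => ?_⟩
  have h1 := hK h |t| z r hh (abs_nonneg t) hz hz1 hr
  have h2 := mul_le_mul_of_nonneg_left
    (square_term_le (p := p) (z := z) (t := t) hγ hk1 hh hr hm) hC'
  linarith only [h1, h2]

theorem le_of_energy_inequalities {q γ c ε X Y D K₁ K₂ : ℝ} (hq : 0 < q) (hγ : 0 < γ)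
    (hc : 0 ≤ c) (hε : ε = (q * γ - c) / (2 * (q + γ + 1 + c))) (hε0 : 0 < ε)
    (h1 : γ * X - ε * (X + Y) - K₁ * D ≤ Y)
    (h2 : q * Y ≤ c * X + ε * (X + Y) + K₂ * D) :
    Y ≤ 2 * ((c + ε) * K₁ + (γ - ε) * K₂) / (q * γ - c) * D := by
  have hS : 0 < q + γ + 1 + c := by linarith
  have e1 : ε * (q + γ + 1 + c) = (q * γ - c) / 2 := by rw [hε]; field_simp
  have hpos : 0 < q * γ - c := by
    have := mul_pos hε0 hS
    linarith
  have hεγ : 0 ≤ γ - ε := by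
    rw [sub_nonneg, hε, div_le_iff₀ (by positivity)]
    nlinarith [mul_pos hq hγ, mul_nonneg hγ.le hc]
  have h3 := mul_le_mul_of_nonneg_left h2 hεγ
  have h4 := mul_le_mul_of_nonneg_left h1 (show 0 ≤ c + ε by linarith)
  rw [div_mul_eq_mul_div, le_div_iff₀ hpos]
  have h5 : ε * (q + γ + 1 + c) * Y = (q * γ - c) / 2 * Y := by rw [e1]
  nlinarith only [h3, h4, h5]

theorem caccioppoli_estimate {N : ℕ} {H u : EuclideanSpace ℝ (Fin N) → ℝ} {p q γ : ℝ}
    (hH : IsFinslerNorm H) (hp : 2 ≤ p) (hq : p - 1 < q) (hγ : 1 < γ)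
    (hγq : (p - 1) * (γ + 1) ^ 2 / 4 < q * γ) (hu : ContDiff ℝ 1 u)
    (hsol : IsWeakSolutionFinslerP H u p q) (hstab : IsStableFinslerP H u p q) :
    ∃ (C : ℝ) (k : ℕ), k ≠ 0 ∧ ∀ R : ℝ, 0 < R →
      ∃ ζ : EuclideanSpace ℝ (Fin N) → ℝ, Continuous ζ ∧ (∀ x, 0 ≤ ζ x) ∧ (∀ x, ζ x ≤ 1) ∧
        (∀ x ∈ Metric.closedBall 0 R, ζ x = 1) ∧
        (∀ x ∉ Metric.closedBall 0 (2 * R), ζ x = 0) ∧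
        ∫ x, |u x| ^ (q + γ) * ζ x ^ k ≤
          C * (R ^ (-(p * (q + γ) / (q - p + 1))) *
            volume.real (Metric.closedBall (0 : EuclideanSpace ℝ (Fin N)) (2 * R))) := by
  have hd : 0 < q - p + 1 := by linarith
  have hp0 : 0 < p := by linarith
  have hq0 : 0 < q := by linarith
  obtain ⟨k, hk⟩ := exists_nat_ge (max 1 (p * (q + γ) / (2 * (q - p + 1))))
  have hk1 : 1 ≤ k := by exact_mod_cast (le_max_left _ _).trans hk
  have hk2 : p * (q + γ) ≤ 2 * k * (q - p + 1) := by
    have := (le_max_right _ _).trans hk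
    rw [div_le_iff₀ (by positivity)] at this
    linarith
  obtain ⟨c, hc⟩ : ∃ c, c = (p - 1) * (γ + 1) ^ 2 / 4 := ⟨_, rfl⟩
  have hc0 : 0 ≤ c := by
    have : 0 ≤ p - 1 := by linarith
    rw [hc]; positivity
  obtain ⟨ε, hε⟩ : ∃ ε, ε = (q * γ - c) / (2 * (q + γ + 1 + c)) := ⟨_, rfl⟩
  have hε0 : 0 < ε := by
    rw [hε]; exact div_pos (by rw [hc]; linarith) (by positivity)
  obtain ⟨C₁, hC₁0, hC₁⟩ := hH.exists_inner_gradient_le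
  obtain ⟨C₂, hC₂0, hC₂⟩ := exists_cutoff N
  obtain ⟨C₃, hC₃0, hC₃⟩ := hH.exists_hessian_le hp
  obtain ⟨K₁, hK₁0, hK₁⟩ := weak_integrand_lower_bound hp hq hγ hk1 hk2
    (mul_nonneg hC₁0 hC₂0) hε0
  obtain ⟨K₂, hK₂0, hK₂⟩ := stability_integrand_upper_bound hp hq hγ hk1 hk2
    (mul_nonneg hC₁0 hC₂0) (half_pos hε0)
  obtain ⟨K₃, hK₃0, hK₃⟩ := hessian_integrand_upper_bound (C := C₂) hp hq hγ hk1 hk2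
    hC₃0 (half_pos hε0)
  refine ⟨2 * ((c + ε) * K₁ + (γ - ε) * (K₂ + K₃)) / (q * γ - c), 2 * k, by omega,
    fun R hR => ?_⟩
  obtain ⟨ζ, hζ, hζ0, hζ1, hζR, hζz, hζg, hζb⟩ := hC₂ R hR
  refine ⟨ζ, hζ.continuous, hζ0, hζ1, hζR, hζz, ?_⟩
  have hb : ∀ x, |⟪gradient H (gradient u x), gradient ζ x⟫| ≤ C₁ * C₂ * R⁻¹ := fun x =>
    (hC₁ _ _).trans (by rw [mul_assoc]; gcongr; exact hζb x)
  have hh : ∀ x, 0 ≤ H (gradient u x) := fun x => hH.nonneg _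
  have hhc : Continuous fun x => H (gradient u x) := hH.continuous.comp (continuous_gradient hu)
  have hζc := hζ.continuous
  have hcpt := isCompact_closedBall (0 : EuclideanSpace ℝ (Fin N)) (2 * R)
  set A := fun x => H (gradient u x) ^ p * |u x| ^ (γ - 1) * ζ x ^ (2 * k) with hA
  set B := fun x => |u x| ^ (q + γ) * ζ x ^ (2 * k) with hB
  set D := R ^ (-(p * (q + γ) / (q - p + 1))) with hD
  have hD0 : 0 ≤ D := by positivity
  have hAz : ∀ x ∉ Metric.closedBall 0 (2 * R), A x = 0 := fun x hx => by
    simp [hA, hζz x hx, show k ≠ 0 by omega]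
  have hBz : ∀ x ∉ Metric.closedBall 0 (2 * R), B x = 0 := fun x hx => by
    simp [hB, hζz x hx, show k ≠ 0 by omega]
  have hA0 : ∀ x, 0 ≤ A x := fun x => by
    have := hh x; have := hζ0 x; positivity
  have hB0 : ∀ x, 0 ≤ B x := fun x => by
    have := hζ0 x; positivity
  have hua : ∀ a : ℝ, 0 ≤ a → Continuous fun x => |u x| ^ a := fun a ha =>
    hu.continuous.abs.rpow_const fun _ => Or.inr ha
  have hAi : Integrable A := by
    refine Continuous.integrable_of_hasCompactSupport ?_ (HasCompactSupport.intro hcpt hAz)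
    exact ((hhc.rpow_const fun _ => Or.inr hp0.le).mul (hua _ (by linarith))).mul (hζc.pow _)
  have hBi : Integrable B :=
    ((hua _ (by linarith)).mul (hζc.pow _)).integrable_of_hasCompactSupport
      (HasCompactSupport.intro hcpt hBz)
  set S := Metric.closedBall (0 : EuclideanSpace ℝ (Fin N)) (2 * R) with hS
  have hSm : MeasurableSet S := Metric.isClosed_closedBall.measurableSet
  have hI : ∀ K : ℝ, Integrable fun x => S.indicator (fun _ => K) x := fun K =>
    (integrable_indicator_iff hSm).2
      (integrableOn_const hcpt.measure_lt_top.ne)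
  have hIv : ∀ K : ℝ, ∫ x, S.indicator (fun _ => K) x = K * volume.real S := fun K => by
    rw [integral_indicator_const _ hSm, smul_eq_mul, mul_comm]
  have hAc : ∀ e : ℝ, Integrable fun x => e * A x := fun e => hAi.const_mul e
  have hABi : ∀ e : ℝ, Integrable fun x => e * (A x + B x) := fun e => (hAi.add hBi).const_mul e
  have hud := hu.differentiable (by norm_num)
  have hζd := hζ.differentiable (by norm_num)
  -- the weak formulation tested with `|u|^(γ-1) u ζ^(2k)`
  have hweak : γ * (∫ x, A x) - ε * ((∫ x, A x) + ∫ x, B x) - K₁ * (D * volume.real S) ≤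
      ∫ x, B x := by
    have hφ : ContDiff ℝ 1 fun x => |u x| ^ (γ - 1) * u x * ζ x ^ (2 * k) :=
      ((contDiff_abs_rpow_mul_self (by linarith)).comp hu).mul (hζ.pow _)
    have hφs : HasCompactSupport fun x => |u x| ^ (γ - 1) * u x * ζ x ^ (2 * k) :=
      HasCompactSupport.intro hcpt fun x hx => by simp [hζz x hx, show k ≠ 0 by omega]
    have h1 := hsol _ hφ hφs
    have h2 : ∀ x, |u x| ^ (q - 1) * u x * (|u x| ^ (γ - 1) * u x * ζ x ^ (2 * k)) = B x :=
      fun x => by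
        have : |u x| ^ (q + γ) = |u x| ^ (q - 1) * |u x| ^ (γ - 1) * |u x| ^ 2 := by
          rw [← Real.rpow_add_of_nonneg (abs_nonneg _) (by linarith) (by linarith),
            ← Real.rpow_natCast, ← Real.rpow_add_of_nonneg (abs_nonneg _) (by linarith)
              (by norm_num)]
          congr 1; push_cast; ring
        simp only [hB, this, sq_abs]; ring
    simp only [h2] at h1
    have hint : Integrable fun x => H (gradient u x) ^ (p - 1) *
        ⟪gradient H (gradient u x),
          gradient (fun x => |u x| ^ (γ - 1) * u x * ζ x ^ (2 * k)) x⟫ := by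
      have hgc := continuous_gradient hφ
      have hgz : ∀ x ∉ S, gradient (fun x => |u x| ^ (γ - 1) * u x * ζ x ^ (2 * k)) x = 0 :=
        fun x hx => by
          rw [gradient_abs_rpow_mul_pow (by linarith) _ (hud x) (hζd x), hζz x hx, hζg x hx]
          simp [show k ≠ 0 by omega]
      have hdom : Integrable fun x => H (gradient u x) ^ (p - 1) * (C₁ *
          ‖gradient (fun x => |u x| ^ (γ - 1) * u x * ζ x ^ (2 * k)) x‖) := by
        refine Continuous.integrable_of_hasCompactSupport ?_
          (HasCompactSupport.intro hcpt fun x hx => by rw [hgz x hx]; simp)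
        exact (hhc.rpow_const fun _ => Or.inr (by linarith)).mul (continuous_const.mul hgc.norm)
      refine hdom.mono' ?_ (Filter.Eventually.of_forall fun x => ?_)
      · exact ((hhc.measurable.pow_const _).mul
          ((IsFinslerNorm.measurable_gradient.comp (continuous_gradient hu).measurable).inner
            hgc.measurable)).aestronglyMeasurable
      · rw [norm_mul, Real.norm_eq_abs, Real.norm_eq_abs,
          abs_of_nonneg (Real.rpow_nonneg (hh x) _)]
        exact mul_le_mul_of_nonneg_left (hC₁ _ _) (Real.rpow_nonneg (hh x) _)
    have h3 : ∀ x, γ * A x - ε * (A x + B x) - S.indicator (fun _ => K₁ * D) x ≤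
        H (gradient u x) ^ (p - 1) * ⟪gradient H (gradient u x),
          gradient (fun x => |u x| ^ (γ - 1) * u x * ζ x ^ (2 * k)) x⟫ := fun x => by
      rw [gradient_abs_rpow_mul_pow (by linarith) _ (hud x) (hζd x), inner_add_right,
        inner_smul_right, inner_smul_right, hH.inner_gradient_self]
      by_cases hx : x ∈ S
      · rw [Set.indicator_of_mem hx]
        exact hK₁ _ _ _ _ _ (hh x) (hζ0 x) (hζ1 x) hR (hb x)
      · rw [Set.indicator_of_notMem hx, hAz x hx, hBz x hx, hζz x hx, hζg x hx]
        simp [show k ≠ 0 by omega]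
    have hsub : Integrable fun x => γ * A x - ε * (A x + B x) := (hAc γ).sub (hABi ε)
    have h4 := integral_mono (hsub.sub (hI (K₁ * D))) hint h3
    calc _ = ∫ x, γ * A x - ε * (A x + B x) - S.indicator (fun _ => K₁ * D) x := by
          rw [integral_sub hsub (hI (K₁ * D)), integral_sub (hAc γ) (hABi ε), integral_const_mul,
            integral_const_mul, integral_add hAi hBi, hIv]
          ring
      _ ≤ _ := h4.trans_eq h1
  -- the stability inequality tested with `|u|^((γ-1)/2) u ζ^k`
  have hstab' : q * (∫ x, B x) ≤ c * (∫ x, A x) + ε * ((∫ x, A x) + ∫ x, B x) +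
      (K₂ + K₃) * (D * volume.real S) := by
    have hγ2 : 0 < (γ - 1) / 2 := by linarith
    have hφ : ContDiff ℝ 1 fun x => |u x| ^ ((γ - 1) / 2) * u x * ζ x ^ k :=
      ((contDiff_abs_rpow_mul_self hγ2).comp hu).mul (hζ.pow _)
    have hφs : HasCompactSupport fun x => |u x| ^ ((γ - 1) / 2) * u x * ζ x ^ k :=
      HasCompactSupport.intro hcpt fun x hx => by simp [hζz x hx, show k ≠ 0 by omega]
    have h1 := hstab _ hφ hφs
    have h2 : ∀ x, q * |u x| ^ (q - 1) * (|u x| ^ ((γ - 1) / 2) * u x * ζ x ^ k) ^ 2 = q * B x :=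
      fun x => by
        have : |u x| ^ (q + γ) = |u x| ^ (q - 1) * (|u x| ^ ((γ - 1) / 2)) ^ 2 * |u x| ^ 2 := by
          rw [← Real.rpow_mul_natCast (abs_nonneg _),
            ← Real.rpow_add_of_nonneg (abs_nonneg _) (by linarith)
              (by push_cast; linarith),
            ← Real.rpow_natCast, ← Real.rpow_add_of_nonneg (abs_nonneg _)
              (by push_cast; linarith) (by norm_num)]
          congr 1; push_cast; ring
        simp only [hB, this, sq_abs]; ring
    simp only [h2] at h1
    rw [integral_const_mul] at h1
    have hadd : Integrable fun x => c * A x + ε / 2 * (A x + B x) := (hAc c).add (hABi (ε / 2))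
    have h3 : ∫ x, (p - 1) * H (gradient u x) ^ (p - 2) * ⟪gradient H (gradient u x),
        gradient (fun x => |u x| ^ ((γ - 1) / 2) * u x * ζ x ^ k) x⟫ ^ 2 ≤
        ∫ x, c * A x + ε / 2 * (A x + B x) + S.indicator (fun _ => K₂ * D) x := by
      refine integral_le_of_le_nonneg
        (hadd.add (hI _))
        (fun x => ?_) fun x => ?_
      · have := hA0 x
        have := hB0 x
        have := Set.indicator_nonneg (s := S) (f := fun _ => K₂ * D)
          (fun _ _ => mul_nonneg hK₂0 hD0) x
        positivity
      rw [gradient_abs_rpow_mul_pow hγ2 _ (hud x) (hζd x), inner_add_right,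
        inner_smul_right, inner_smul_right, hH.inner_gradient_self]
      by_cases hx : x ∈ S
      · rw [Set.indicator_of_mem hx, hc]
        exact hK₂ _ _ _ _ _ (hh x) (hζ0 x) (hζ1 x) hR (hb x)
      · rw [Set.indicator_of_notMem hx, hAz x hx, hBz x hx, hζz x hx, hζg x hx]
        simp [show k ≠ 0 by omega]
    have h4 : ∫ x, H (gradient u x) ^ (p - 1) * ⟪fderiv ℝ (gradient H) (gradient u x)
        (gradient (fun x => |u x| ^ ((γ - 1) / 2) * u x * ζ x ^ k) x),
        gradient (fun x => |u x| ^ ((γ - 1) / 2) * u x * ζ x ^ k) x⟫ ≤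
        ∫ x, ε / 2 * (A x + B x) + S.indicator (fun _ => K₃ * D) x := by
      refine integral_le_of_le_nonneg
        ((hABi (ε / 2)).add (hI _)) (fun x => ?_) fun x => ?_
      · have := hA0 x
        have := hB0 x
        have := Set.indicator_nonneg (s := S) (f := fun _ => K₃ * D)
          (fun _ _ => mul_nonneg hK₃0 hD0) x
        positivity
      rw [gradient_abs_rpow_mul_pow hγ2 _ (hud x) (hζd x)]
      by_cases hx : x ∈ S
      · rw [Set.indicator_of_mem hx]
        exact (hC₃ _ _ _ _).trans (hK₃ _ _ _ _ _ (hh x) (hζ0 x) (hζ1 x) hR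
          (by rw [abs_norm]; exact hζb x))
      · rw [Set.indicator_of_notMem hx, hAz x hx, hBz x hx, hζz x hx, hζg x hx]
        simp [show k ≠ 0 by omega]
    rw [integral_add hadd (hI (K₂ * D)), integral_add (hAc c) (hABi (ε / 2)), integral_const_mul,
      integral_const_mul, integral_add hAi hBi, hIv] at h3
    rw [integral_add (hABi (ε / 2)) (hI (K₃ * D)), integral_const_mul,
      integral_add hAi hBi, hIv] at h4
    linarith only [h1, h3, h4]
  exact le_of_energy_inequalities hq0 (by linarith) hc0 hε hε0 hweak hstab'

/-- Corollary 1.4: Liouville theorem for stable solutions of the pure Finsler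
`p`-Laplace equation with subcritical exponent. -/
theorem liouville_finsler_pLaplacian {N : ℕ} (hN : 2 ≤ N)
    (H : EuclideanSpace ℝ (Fin N) → ℝ) (u : EuclideanSpace ℝ (Fin N) → ℝ) (p q : ℝ)
    (hH : IsFinslerNorm H) (hp : 2 ≤ p) (hu : ContDiff ℝ 1 u)
    (hsol : IsWeakSolutionFinslerP H u p q)
    (hstab : IsStableFinslerP H u p q)
    (hcond : (p - 1 < q ∧ (N : ℝ) ≤ p * (p + 3) / (p - 1)) ∨
      ((N : ℝ) > p * (p + 3) / (p - 1) ∧ p - 1 < q ∧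
        q < (((p - 1) * N - p) ^ 2 + p ^ 2 * (p - 2) - p ^ 2 * (p - 1) * N +
              2 * p ^ 2 * Real.sqrt ((p - 1) * (N - 1))) /
            (((N : ℝ) - p) * ((p - 1) * N - p * (p + 3))))) :
    ∀ x, u x = 0 := by
  have hq : p - 1 < q := by rcases hcond with h | h <;> [exact h.1; exact h.2.1]
  obtain ⟨γ, hγ, hγq, hN'⟩ := exists_subcritical_exponent hp hcond
  obtain ⟨C, k, hk, hC⟩ := caccioppoli_estimate hH hp hq hγ hγq hu hsol hstab
  have hd : 0 < q - p + 1 := by linarith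
  have hqγ : 0 < q + γ := by linarith
  intro x₀
  by_contra hx₀
  obtain ⟨ζ, hζc, hζ0, hζ1, hζR, hζz, -⟩ := hC (‖x₀‖ + 1) (by positivity)
  set R₀ := ‖x₀‖ + 1 with hR₀
  have hR₀0 : 0 < R₀ := by positivity
  have huc : Continuous fun x => |u x| ^ (q + γ) :=
    hu.continuous.abs.rpow_const fun _ => Or.inr hqγ.le
  have hint : ∀ (f : EuclideanSpace ℝ (Fin N) → ℝ) (R : ℝ), Continuous f →
      (∀ x ∉ Metric.closedBall 0 (2 * R), f x = 0) →
      HasCompactSupport fun x => |u x| ^ (q + γ) * f x ^ k := fun f R hf hz =>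
    HasCompactSupport.intro (isCompact_closedBall 0 (2 * R)) fun x hx => by
      simp [hz x hx, hk]
  have hpos : 0 < ∫ x, |u x| ^ (q + γ) * ζ x ^ k := by
    refine (huc.mul (hζc.pow k)).integral_pos_of_hasCompactSupport_nonneg_nonzero (x := x₀)
      (hint ζ R₀ hζc hζz) (fun x => ?_) ?_
    · have := hζ0 x
      change 0 ≤ |u x| ^ (q + γ) * ζ x ^ k
      positivity
    · have : 0 < |u x₀| := abs_pos.2 hx₀
      rw [hζR x₀ (by rw [mem_closedBall_zero_iff]; linarith), one_pow, mul_one]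
      positivity
  have hle : ∀ R, 2 * R₀ ≤ R → ∫ x, |u x| ^ (q + γ) * ζ x ^ k ≤
      C * (2 ^ N * volume.real (Metric.ball (0 : EuclideanSpace ℝ (Fin N)) 1)) *
        R ^ (-(p * (q + γ) / (q - p + 1) - N)) := fun R hR => by
    have hR0 : 0 < R := by linarith
    obtain ⟨η, hηc, hη0, hη1, hηR, hηz, hη⟩ := hC R hR0
    calc ∫ x, |u x| ^ (q + γ) * ζ x ^ k ≤ ∫ x, |u x| ^ (q + γ) * η x ^ k := by
          refine integral_mono
            ((huc.mul (hζc.pow k)).integrable_of_hasCompactSupport (hint ζ R₀ hζc hζz))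
            ((huc.mul (hηc.pow k)).integrable_of_hasCompactSupport (hint η R hηc hηz))
            fun x => mul_le_mul_of_nonneg_left (pow_le_pow_left₀ (hζ0 x) ?_ k)
              (Real.rpow_nonneg (abs_nonneg _) _)
          by_cases hx : x ∈ Metric.closedBall 0 (2 * R₀)
          · rw [hηR x (Metric.closedBall_subset_closedBall hR hx)]
            exact hζ1 x
          · rw [hζz x hx]
            exact hη0 x
      _ ≤ _ := hη
      _ = _ := by
          rw [Measure.addHaar_real_closedBall _ _ (by positivity), finrank_euclideanSpace_fin,
            show -(p * (q + γ) / (q - p + 1) - (N : ℝ)) = -(p * (q + γ) / (q - p + 1)) + N by ring,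
            Real.rpow_add hR0, Real.rpow_natCast, mul_pow]
          ring
  have hlim : Filter.Tendsto (fun R : ℝ =>
      C * (2 ^ N * volume.real (Metric.ball (0 : EuclideanSpace ℝ (Fin N)) 1)) *
        R ^ (-(p * (q + γ) / (q - p + 1) - N))) Filter.atTop (nhds 0) := by
    have h1 : 0 < p * (q + γ) / (q - p + 1) - N := by
      rw [sub_pos, lt_div_iff₀ hd]
      exact hN'
    simpa using (tendsto_rpow_neg_atTop h1).const_mul
      (C * (2 ^ N * volume.real (Metric.ball (0 : EuclideanSpace ℝ (Fin N)) 1)))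
  exact absurd hpos (not_lt.2 (ge_of_tendsto hlim
    (Filter.eventually_atTop.2 ⟨2 * R₀, hle⟩)))
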